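/- arXiv:2401.13134 — 5 statements merged into one kernel-verified Lean document; each statement's English description precedes it below -/
import Mathlib

section
/- For every x ∈ ℝ^d with |x| = 1 and every orthonormal pair (e₁,e₂): √(1 - |P_j x|²) = |⟨x,u_j⟩| for j = 1,2,3, and √(1 - |P₁x|²) + √(1 - |P₂x|²) + √(1 - |P₃x|²) = |⟨x,u₁⟩| + |⟨x,u₂⟩| + |⟨x,u₃⟩| = 2·max_j |⟨x,u_j⟩| ≤ 2, with equality 2 attained if and only if x = u_j or x = -u_j for some j ∈ {1,2,3}. -/
open scoped RealInnerProductSpace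

/-- Orthogonal projection of `x` onto the hyperplane `w^⊥`. -/
noncomputable def projPerp {d : ℕ} (x w : EuclideanSpace ℝ (Fin d)) :
    EuclideanSpace ℝ (Fin d) :=
  x - ⟪x, w⟫ • w

theorem sqrt_one_sub_norm_projPerp_sq {d : ℕ} {x w : EuclideanSpace ℝ (Fin d)}
    (hx : ‖x‖ = 1) (hw : ‖w‖ = 1) :
    Real.sqrt (1 - ‖projPerp x w‖ ^ 2) = |⟪x, w⟫| := by
  have h : 1 - ‖projPerp x w‖ ^ 2 = ⟪x, w⟫ ^ 2 := by
    rw [projPerp, norm_sub_sq_real, inner_smul_right, norm_smul, hx, hw, mul_one,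
      Real.norm_eq_abs, sq_abs]
    ring
  rw [h, Real.sqrt_sq_eq_abs]

theorem abs_add_abs_add_abs_eq_two_mul_max {a b c : ℝ} (h : a + b + c = 0) :
    |a| + |b| + |c| = 2 * max (max |a| |b|) |c| := by
  grind

theorem abs_add_abs_add_abs_eq_two_iff {a b c : ℝ} (h : a + b + c = 0)
    (ha : |a| ≤ 1) (hb : |b| ≤ 1) (hc : |c| ≤ 1) :
    |a| + |b| + |c| = 2 ↔ |a| = 1 ∨ |b| = 1 ∨ |c| = 1 := by
  rw [abs_add_abs_add_abs_eq_two_mul_max h]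
  generalize |a| = a, |b| = b, |c| = c at ha hb hc ⊢
  clear h
  grind

theorem abs_real_inner_eq_one_iff_eq_or_eq_neg {E : Type*} [NormedAddCommGroup E]
    [InnerProductSpace ℝ E] {x w : E} (hx : ‖x‖ = 1) (hw : ‖w‖ = 1) :
    |⟪x, w⟫| = 1 ↔ x = w ∨ x = -w := by
  rw [abs_eq zero_le_one, inner_eq_one_iff_of_norm_eq_one (𝕜 := ℝ) hx hw,
    ← inner_eq_one_iff_of_norm_eq_one (𝕜 := ℝ) hx ((norm_neg w).trans hw), inner_neg_right,
    neg_eq_iff_eq_neg]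

theorem norm_smul_add_smul_eq_one {E : Type*} [NormedAddCommGroup E]
    [InnerProductSpace ℝ E] {e f : E} (he : ‖e‖ = 1) (hf : ‖f‖ = 1) (hef : ⟪e, f⟫ = 0)
    {a b : ℝ} (hab : a ^ 2 + b ^ 2 = 1) : ‖a • e + b • f‖ = 1 := by
  rw [← sq_eq_sq₀ (norm_nonneg _) zero_le_one, norm_add_sq_real, inner_smul_left,
    inner_smul_right, hef, norm_smul, norm_smul, he, hf]
  simpa using hab

theorem stmt8 {d : ℕ} (hd : 2 ≤ d) (e₁ e₂ x : EuclideanSpace ℝ (Fin d))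
    (he₁ : ‖e₁‖ = 1) (he₂ : ‖e₂‖ = 1) (he : ⟪e₁, e₂⟫ = 0)
    (hx : ‖x‖ = 1)
    (u₁ u₂ u₃ : EuclideanSpace ℝ (Fin d))
    (hu₁ : u₁ = e₁)
    (hu₂ : u₂ = -(1 / 2 : ℝ) • e₁ + (Real.sqrt 3 / 2) • e₂)
    (hu₃ : u₃ = -(1 / 2 : ℝ) • e₁ - (Real.sqrt 3 / 2) • e₂) :
    Real.sqrt (1 - ‖projPerp x u₁‖ ^ 2) = |⟪x, u₁⟫| ∧
    Real.sqrt (1 - ‖projPerp x u₂‖ ^ 2) = |⟪x, u₂⟫| ∧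
    Real.sqrt (1 - ‖projPerp x u₃‖ ^ 2) = |⟪x, u₃⟫| ∧
    Real.sqrt (1 - ‖projPerp x u₁‖ ^ 2) + Real.sqrt (1 - ‖projPerp x u₂‖ ^ 2) +
        Real.sqrt (1 - ‖projPerp x u₃‖ ^ 2) =
      |⟪x, u₁⟫| + |⟪x, u₂⟫| + |⟪x, u₃⟫| ∧
    |⟪x, u₁⟫| + |⟪x, u₂⟫| + |⟪x, u₃⟫| = 2 * max (max |⟪x, u₁⟫| |⟪x, u₂⟫|) |⟪x, u₃⟫| ∧
    |⟪x, u₁⟫| + |⟪x, u₂⟫| + |⟪x, u₃⟫| ≤ 2 ∧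
    (|⟪x, u₁⟫| + |⟪x, u₂⟫| + |⟪x, u₃⟫| = 2 ↔
      (x = u₁ ∨ x = -u₁ ∨ x = u₂ ∨ x = -u₂ ∨ x = u₃ ∨ x = -u₃)) := by
  have h3 : Real.sqrt 3 ^ 2 = 3 := Real.sq_sqrt (by norm_num)
  have n₁ : ‖u₁‖ = 1 := hu₁ ▸ he₁
  have n₂ : ‖u₂‖ = 1 := hu₂ ▸ norm_smul_add_smul_eq_one he₁ he₂ he (by linarith)
  have n₃ : ‖u₃‖ = 1 := by
    rw [hu₃, sub_eq_add_neg, ← neg_smul]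
    exact norm_smul_add_smul_eq_one he₁ he₂ he (by linarith)
  have hsum : ⟪x, u₁⟫ + ⟪x, u₂⟫ + ⟪x, u₃⟫ = 0 := by
    rw [← inner_add_right, ← inner_add_right, hu₁, hu₂, hu₃]
    convert inner_zero_right x
    module
  have hle {w : EuclideanSpace ℝ (Fin d)} (hw : ‖w‖ = 1) : |⟪x, w⟫| ≤ 1 := by
    simpa [hx, hw] using abs_real_inner_le_norm x w
  have hmax := abs_add_abs_add_abs_eq_two_mul_max hsum
  have hmax_le : max (max |⟪x, u₁⟫| |⟪x, u₂⟫|) |⟪x, u₃⟫| ≤ 1 :=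
    max_le (max_le (hle n₁) (hle n₂)) (hle n₃)
  rw [sqrt_one_sub_norm_projPerp_sq hx n₁, sqrt_one_sub_norm_projPerp_sq hx n₂,
    sqrt_one_sub_norm_projPerp_sq hx n₃]
  refine ⟨rfl, rfl, rfl, rfl, hmax, by linarith, ?_⟩
  rw [abs_add_abs_add_abs_eq_two_iff hsum (hle n₁) (hle n₂) (hle n₃),
    abs_real_inner_eq_one_iff_eq_or_eq_neg hx n₁, abs_real_inner_eq_one_iff_eq_or_eq_neg hx n₂,
    abs_real_inner_eq_one_iff_eq_or_eq_neg hx n₃]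
  simp only [or_assoc]
end

section
/- Let L₁, L₂, L₃ > 0 be real numbers. Suppose v ∈ ℝ^d, α₁, α₂, α₃ ∈ ℝ, and η₁, η₂, η₃ ∈ ℝ^d satisfy: ⟨η_j, u_j⟩ = 0 for each j, η₁ + η₂ + η₃ = 0, and v + α_j u_j + L_j η_j = 0 for j = 1, 2, 3. Then v = 0, α₁ = α₂ = α₃ = 0, and η₁ = η₂ = η₃ = 0. (This is the injectivity of the endpoint differential of the family of Euclidean triods, Lemma 3.3 of the paper in the Euclidean case.) -/
open scoped RealInnerProductSpace

lemma inner_eq_neg_mul_norm_sq_of_add_smul_add_smul_eq_zero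
    {E : Type*} [NormedAddCommGroup E] [InnerProductSpace ℝ E] {v u η : E} {α L : ℝ}
    (hη : ⟪η, u⟫ = 0) (h : v + α • u + L • η = 0) : ⟪η, v⟫ = -(L * ‖η‖ ^ 2) := by
  have key : ⟪η, v + α • u + L • η⟫ = 0 := by rw [h, inner_zero_right]
  rw [inner_add_right, inner_add_right, inner_smul_right, inner_smul_right, hη,
    real_inner_self_eq_norm_sq] at key
  linarith

theorem stmt9 {d : ℕ} (hd : 2 ≤ d) (e₁ e₂ : EuclideanSpace ℝ (Fin d))
    (he₁ : ‖e₁‖ = 1) (he₂ : ‖e₂‖ = 1) (he : ⟪e₁, e₂⟫ = 0)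
    (u₁ u₂ u₃ : EuclideanSpace ℝ (Fin d))
    (hu₁ : u₁ = e₁)
    (hu₂ : u₂ = -(1 / 2 : ℝ) • e₁ + (Real.sqrt 3 / 2) • e₂)
    (hu₃ : u₃ = -(1 / 2 : ℝ) • e₁ - (Real.sqrt 3 / 2) • e₂)
    (L₁ L₂ L₃ : ℝ) (hL₁ : 0 < L₁) (hL₂ : 0 < L₂) (hL₃ : 0 < L₃)
    (v : EuclideanSpace ℝ (Fin d)) (α₁ α₂ α₃ : ℝ)
    (η₁ η₂ η₃ : EuclideanSpace ℝ (Fin d))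
    (hη₁ : ⟪η₁, u₁⟫ = 0) (hη₂ : ⟪η₂, u₂⟫ = 0) (hη₃ : ⟪η₃, u₃⟫ = 0)
    (hηsum : η₁ + η₂ + η₃ = 0)
    (h₁ : v + α₁ • u₁ + L₁ • η₁ = 0)
    (h₂ : v + α₂ • u₂ + L₂ • η₂ = 0)
    (h₃ : v + α₃ • u₃ + L₃ • η₃ = 0) :
    v = 0 ∧ α₁ = 0 ∧ α₂ = 0 ∧ α₃ = 0 ∧ η₁ = 0 ∧ η₂ = 0 ∧ η₃ = 0 := by
  have hsum : ⟪η₁, v⟫ + ⟪η₂, v⟫ + ⟪η₃, v⟫ = 0 := by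
    rw [← inner_add_left, ← inner_add_left, hηsum, inner_zero_left]
  rw [inner_eq_neg_mul_norm_sq_of_add_smul_add_smul_eq_zero hη₁ h₁,
    inner_eq_neg_mul_norm_sq_of_add_smul_add_smul_eq_zero hη₂ h₂,
    inner_eq_neg_mul_norm_sq_of_add_smul_add_smul_eq_zero hη₃ h₃] at hsum
  have p₁ : 0 ≤ L₁ * ‖η₁‖ ^ 2 := by positivity
  have p₂ : 0 ≤ L₂ * ‖η₂‖ ^ 2 := by positivity
  have p₃ : 0 ≤ L₃ * ‖η₃‖ ^ 2 := by positivity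
  have η₁_zero : η₁ = 0 := by
    have : L₁ * ‖η₁‖ ^ 2 = 0 := by linarith
    simpa [hL₁.ne'] using this
  have η₂_zero : η₂ = 0 := by
    have : L₂ * ‖η₂‖ ^ 2 = 0 := by linarith
    simpa [hL₂.ne'] using this
  have η₃_zero : η₃ = 0 := by
    have : L₃ * ‖η₃‖ ^ 2 = 0 := by linarith
    simpa [hL₃.ne'] using this
  subst hu₁ hu₂ hu₃
  rw [η₁_zero, smul_zero, add_zero] at h₁
  rw [η₂_zero, smul_zero, add_zero] at h₂
  rw [η₃_zero, smul_zero, add_zero] at h₃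
  have hv : ⟪v, e₂⟫ = 0 := by
    have := congrArg (fun x => ⟪x, e₂⟫) h₁
    simpa [inner_add_left, inner_smul_left, he] using this
  have α₂_zero : α₂ = 0 := by
    have := congrArg (fun x => ⟪x, e₂⟫) h₂
    simpa [inner_add_left, inner_smul_left, he, hv, he₂] using this
  have α₃_zero : α₃ = 0 := by
    have := congrArg (fun x => ⟪x, e₂⟫) h₃
    simpa [inner_add_left, inner_sub_left, inner_smul_left, he, hv, he₂] using this
  have v_zero : v = 0 := by simpa [α₂_zero] using h₂
  have e₁_ne : u₁ ≠ 0 := by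
    rintro rfl
    simp at he₁
  have α₁_zero : α₁ = 0 := by simpa [v_zero, e₁_ne] using h₁
  exact ⟨v_zero, α₁_zero, α₂_zero, α₃_zero, η₁_zero, η₂_zero, η₃_zero⟩
end

section
/- Let x ∈ ℝ^{d+1} be a unit vector and e₁, e₂ ∈ ℝ^{d+1} orthonormal vectors orthogonal to x, with u₁, u₂, u₃ the associated equiangular unit vectors. Suppose v, η₁, η₂, η₃ ∈ ℝ^{d+1} satisfy η₁ + η₂ + η₃ = 0 and, for each j = 1, 2, 3, the equation 2(η_j + ⟨v,u_j⟩x) + (π/2)(v - ⟨v,u_j⟩u_j) = 0. Then v = 0 and η₁ = η₂ = η₃ = 0. (This is the injectivity statement of Lemma 4.3 of the paper in the case of the round metric and antipodal junctions.) -/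
open scoped RealInnerProductSpace

theorem stmt13 {d : ℕ} (hd : 2 ≤ d)
    (x e₁ e₂ : EuclideanSpace ℝ (Fin (d + 1)))
    (hx : ‖x‖ = 1) (he₁ : ‖e₁‖ = 1) (he₂ : ‖e₂‖ = 1) (he : ⟪e₁, e₂⟫ = 0)
    (hxe₁ : ⟪x, e₁⟫ = 0) (hxe₂ : ⟪x, e₂⟫ = 0)
    (u₁ u₂ u₃ : EuclideanSpace ℝ (Fin (d + 1)))
    (hu₁ : u₁ = e₁)
    (hu₂ : u₂ = -(1 / 2 : ℝ) • e₁ + (Real.sqrt 3 / 2) • e₂)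
    (hu₃ : u₃ = -(1 / 2 : ℝ) • e₁ - (Real.sqrt 3 / 2) • e₂)
    (v η₁ η₂ η₃ : EuclideanSpace ℝ (Fin (d + 1)))
    (hηsum : η₁ + η₂ + η₃ = 0)
    (h₁ : (2 : ℝ) • (η₁ + ⟪v, u₁⟫ • x) + (Real.pi / 2) • (v - ⟪v, u₁⟫ • u₁) = 0)
    (h₂ : (2 : ℝ) • (η₂ + ⟪v, u₂⟫ • x) + (Real.pi / 2) • (v - ⟪v, u₂⟫ • u₂) = 0)
    (h₃ : (2 : ℝ) • (η₃ + ⟪v, u₃⟫ • x) + (Real.pi / 2) • (v - ⟪v, u₃⟫ • u₃) = 0) :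
    v = 0 ∧ η₁ = 0 ∧ η₂ = 0 ∧ η₃ = 0 := by
  have hu₂v : ⟪v, u₂⟫ = -(1 / 2) * ⟪v, e₁⟫ + Real.sqrt 3 / 2 * ⟪v, e₂⟫ := by
    rw [hu₂, inner_add_right, real_inner_smul_right, real_inner_smul_right]
  have hu₃v : ⟪v, u₃⟫ = -(1 / 2) * ⟪v, e₁⟫ - Real.sqrt 3 / 2 * ⟪v, e₂⟫ := by
    rw [hu₃, inner_sub_right, real_inner_smul_right, real_inner_smul_right]
  rw [hu₁] at h₁
  rw [hu₂v, hu₂] at h₂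
  rw [hu₃v, hu₃] at h₃
  have hsqrt : (Real.sqrt 3 * Real.sqrt 3 - 3) • e₂ = 0 := by
    rw [Real.mul_self_sqrt (by norm_num), sub_self, zero_smul]
  -- Adding the three equations eliminates the vectors η and the components along x.
  have hsum : (Real.pi / 2) •
      ((3 : ℝ) • v - (3 / 2 : ℝ) • (⟪v, e₁⟫ • e₁ + ⟪v, e₂⟫ • e₂)) = 0 := by
    linear_combination (norm := module) h₁ + h₂ + h₃ - (2 : ℝ) • hηsum
      + (Real.pi / 4 * ⟪v, e₂⟫) • hsqrt
  have hproj := (smul_eq_zero.mp hsum).resolve_left (by positivity)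
  have hv : v = (1 / 2 : ℝ) • (⟪v, e₁⟫ • e₁ + ⟪v, e₂⟫ • e₂) := by
    linear_combination (norm := module) (1 / 3 : ℝ) • hproj
  have hve₁ : ⟪v, e₁⟫ = 0 := by
    have h := congrArg (fun w => ⟪w, e₁⟫) hv
    simp only [real_inner_smul_left, inner_add_left, real_inner_self_eq_norm_sq, he₁,
      real_inner_comm e₁ e₂, he] at h
    linarith
  have hve₂ : ⟪v, e₂⟫ = 0 := by
    have h := congrArg (fun w => ⟪w, e₂⟫) hv
    simp only [real_inner_smul_left, inner_add_left, real_inner_self_eq_norm_sq, he₂, he] at h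
    linarith
  have hv0 : v = 0 := by
    rw [hv, hve₁, hve₂]
    simp
  subst hv0
  simp at h₁ h₂ h₃
  exact ⟨rfl, h₁, h₂, h₃⟩
end

section
/- Let γ : ℝ → ℝ^{d+1} be twice continuously differentiable and k : ℝ → ℝ^{d+1} continuously differentiable, satisfying γ''(s) + γ(s) = k(s) and k'(s) = -|k(s)|²γ'(s) for all s, with initial data satisfying |γ(0)| = 1, |γ'(0)| = 1, ⟨γ(0),γ'(0)⟩ = 0, ⟨γ(0),k(0)⟩ = 0, ⟨γ'(0),k(0)⟩ = 0. Then for all s ∈ ℝ: |γ(s)| = 1, |γ'(s)| = 1, ⟨γ(s),γ'(s)⟩ = 0, ⟨γ(s),k(s)⟩ = 0, ⟨γ'(s),k(s)⟩ = 0, and |k(s)| = |k(0)|. In other words, the solution is a unit-speed curve on the unit sphere whose tangential curvature vector stays normal to the velocity and has constant norm. -/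
open scoped RealInnerProductSpace

/-- A Grönwall-type uniqueness principle, valid in both time directions. -/
theorem eq_zero_of_abs_deriv_le_mul {N N' C : ℝ → ℝ} (hC : Continuous C)
    (hN : ∀ s, HasDerivAt N (N' s) s) (hpos : ∀ s, 0 ≤ N s) (h_zero : N 0 = 0)
    (hle : ∀ s, |N' s| ≤ C s * N s) (s : ℝ) : N s = 0 := by
  have hP : ∀ s, HasDerivAt (fun t => ∫ x in (0 : ℝ)..t, C x) (C s) s := fun s =>
    (hC.integral_hasStrictDerivAt 0 s).hasDerivAt
  have h_anti : Antitone fun t => N t * Real.exp (-∫ x in (0 : ℝ)..t, C x) := by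
    refine antitone_of_hasDerivAt_nonpos (fun t => (hN t).mul (hP t).neg.exp) fun t => ?_
    have := mul_nonneg (Real.exp_pos (-∫ x in (0 : ℝ)..t, C x)).le
      (sub_nonneg.2 ((abs_le.1 (hle t)).2))
    simp only [Pi.zero_apply, Pi.neg_apply]
    linarith
  have h_mono : Monotone fun t => N t * Real.exp (∫ x in (0 : ℝ)..t, C x) := by
    refine monotone_of_hasDerivAt_nonneg (fun t => (hN t).mul (hP t).exp) fun t => ?_
    have := mul_nonneg (Real.exp_pos (∫ x in (0 : ℝ)..t, C x)).le
      (neg_le_iff_add_nonneg.1 ((abs_le.1 (hle t)).1))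
    simp only [Pi.zero_apply]
    linarith
  refine le_antisymm ?_ (hpos s)
  rcases le_total 0 s with hs | hs
  · have := h_anti hs
    simp only [h_zero, zero_mul] at this
    exact nonpos_of_mul_nonpos_left this (Real.exp_pos _)
  · have := h_mono hs
    simp only [h_zero, zero_mul] at this
    exact nonpos_of_mul_nonpos_left this (Real.exp_pos _)

theorem stmt14 {d : ℕ} (hd : 1 ≤ d)
    (γ k : ℝ → EuclideanSpace ℝ (Fin (d + 1)))
    (hγ : ContDiff ℝ 2 γ) (hk : ContDiff ℝ 1 k)
    (hode₁ : ∀ s : ℝ, deriv (deriv γ) s + γ s = k s)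
    (hode₂ : ∀ s : ℝ, deriv k s = -‖k s‖ ^ 2 • deriv γ s)
    (h₁ : ‖γ 0‖ = 1) (h₂ : ‖deriv γ 0‖ = 1)
    (h₃ : ⟪γ 0, deriv γ 0⟫ = 0)
    (h₄ : ⟪γ 0, k 0⟫ = 0) (h₅ : ⟪deriv γ 0, k 0⟫ = 0) :
    ∀ s : ℝ,
      ‖γ s‖ = 1 ∧ ‖deriv γ s‖ = 1 ∧ ⟪γ s, deriv γ s⟫ = 0 ∧
      ⟪γ s, k s⟫ = 0 ∧ ⟪deriv γ s, k s⟫ = 0 ∧ ‖k s‖ = ‖k 0‖ := by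
  have dγ : ∀ s, HasDerivAt γ (deriv γ s) s := fun s =>
    (hγ.differentiable (by norm_num) s).hasDerivAt
  have dT : ∀ s, HasDerivAt (deriv γ) (k s - γ s) s := fun s => by
    have hT : ContDiff ℝ 1 (deriv γ) := hγ.deriv' (n := 1)
    rw [← hode₁ s, add_sub_cancel_right]
    exact (hT.differentiable one_ne_zero s).hasDerivAt
  have dk : ∀ s, HasDerivAt k (-‖k s‖ ^ 2 • deriv γ s) s := fun s => by
    rw [← hode₂ s]
    exact (hk.differentiable one_ne_zero s).hasDerivAt
  have da : ∀ s, HasDerivAt (fun t => ‖γ t‖ ^ 2 - 1) (2 * ⟪γ s, deriv γ s⟫) s := fun s =>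
    (dγ s).norm_sq.sub_const 1
  have db : ∀ s, HasDerivAt (fun t => ⟪γ t, deriv γ t⟫)
      ((‖deriv γ s‖ ^ 2 - 1) - (‖γ s‖ ^ 2 - 1) + ⟪γ s, k s⟫) s := fun s => by
    refine ((dγ s).inner ℝ (dT s)).congr_deriv ?_
    simp only [inner_sub_right, real_inner_self_eq_norm_sq]
    ring
  have dc : ∀ s, HasDerivAt (fun t => ‖deriv γ t‖ ^ 2 - 1)
      (2 * (⟪deriv γ s, k s⟫ - ⟪γ s, deriv γ s⟫)) s := fun s => by
    refine ((dT s).norm_sq.sub_const 1).congr_deriv ?_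
    rw [inner_sub_right, real_inner_comm (γ s)]
  have de : ∀ s, HasDerivAt (fun t => ⟪γ t, k t⟫)
      (⟪deriv γ s, k s⟫ - ‖k s‖ ^ 2 * ⟪γ s, deriv γ s⟫) s := fun s => by
    refine ((dγ s).inner ℝ (dk s)).congr_deriv ?_
    rw [real_inner_smul_right]
    ring
  have df : ∀ s, HasDerivAt (fun t => ⟪deriv γ t, k t⟫)
      (-⟪γ s, k s⟫ - ‖k s‖ ^ 2 * (‖deriv γ s‖ ^ 2 - 1)) s := fun s => by
    refine ((dT s).inner ℝ (dk s)).congr_deriv ?_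
    simp only [real_inner_smul_right, inner_sub_left, real_inner_self_eq_norm_sq]
    ring
  have hN : ∀ s, (‖γ s‖ ^ 2 - 1) ^ 2 + ⟪γ s, deriv γ s⟫ ^ 2 + (‖deriv γ s‖ ^ 2 - 1) ^ 2
      + ⟪γ s, k s⟫ ^ 2 + ⟪deriv γ s, k s⟫ ^ 2 = 0 := by
    refine eq_zero_of_abs_deriv_le_mul (C := fun s => 5 + 2 * ‖k s‖ ^ 2)
      (by have := hk.continuous; fun_prop)
      (fun s => (((((da s).pow 2).add ((db s).pow 2)).add ((dc s).pow 2)).add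
        ((de s).pow 2)).add ((df s).pow 2)) (fun s => by positivity)
      (by simp [h₁, h₂, h₃, h₄, h₅]) fun s => ?_
    have hκ : 0 ≤ ‖k s‖ ^ 2 := by positivity
    generalize ‖k s‖ ^ 2 = κ at *
    generalize ‖γ s‖ ^ 2 - 1 = a
    generalize ‖deriv γ s‖ ^ 2 - 1 = c
    generalize ⟪γ s, deriv γ s⟫ = b
    generalize ⟪γ s, k s⟫ = e
    generalize ⟪deriv γ s, k s⟫ = f
    simp only [Nat.cast_ofNat, Nat.add_one_sub_one, pow_one]
    rw [abs_le]
    constructor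
    · nlinarith [sq_nonneg (a + b), sq_nonneg (b + e), sq_nonneg (b - c), sq_nonneg (c + f),
        mul_nonneg hκ (sq_nonneg (e - b)), mul_nonneg hκ (sq_nonneg (f - c)),
        mul_nonneg hκ (sq_nonneg a), mul_nonneg hκ (sq_nonneg b), mul_nonneg hκ (sq_nonneg c),
        mul_nonneg hκ (sq_nonneg e), mul_nonneg hκ (sq_nonneg f)]
    · nlinarith [sq_nonneg (a - b), sq_nonneg (b - e), sq_nonneg (b + c), sq_nonneg (c - f),
        mul_nonneg hκ (sq_nonneg (e + b)), mul_nonneg hκ (sq_nonneg (f + c)),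
        mul_nonneg hκ (sq_nonneg a), mul_nonneg hκ (sq_nonneg b), mul_nonneg hκ (sq_nonneg c),
        mul_nonneg hκ (sq_nonneg e), mul_nonneg hκ (sq_nonneg f)]
  have hf : ∀ s, ⟪deriv γ s, k s⟫ = 0 := fun s => by
    refine pow_eq_zero_iff two_ne_zero |>.1 (le_antisymm ?_ (sq_nonneg _))
    rw [← hN s]
    exact le_add_of_nonneg_left (by positivity)
  have dκ : ∀ s, HasDerivAt (fun t => ‖k t‖ ^ 2) 0 s := fun s => by
    refine (dk s).norm_sq.congr_deriv ?_
    rw [real_inner_smul_right, real_inner_comm, hf s, mul_zero, mul_zero]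
  intro s
  have key := hN s
  have ha : (‖γ s‖ ^ 2 - 1) = 0 := by
    refine pow_eq_zero_iff two_ne_zero |>.1 (le_antisymm ?_ (sq_nonneg _))
    rw [← key]; simp only [add_assoc]; exact le_add_of_nonneg_right (by positivity)
  have hc : (‖deriv γ s‖ ^ 2 - 1) = 0 := by
    refine pow_eq_zero_iff two_ne_zero |>.1 (le_antisymm ?_ (sq_nonneg _))
    nlinarith [sq_nonneg (‖γ s‖ ^ 2 - 1), sq_nonneg ⟪γ s, deriv γ s⟫, sq_nonneg ⟪γ s, k s⟫,
      sq_nonneg ⟪deriv γ s, k s⟫]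
  rw [ha, hc, hf s] at key
  refine ⟨?_, ?_, ?_, ?_, hf s, ?_⟩
  · exact (sq_eq_sq₀ (norm_nonneg _) zero_le_one).1 (by linarith)
  · exact (sq_eq_sq₀ (norm_nonneg _) zero_le_one).1 (by linarith)
  · nlinarith [sq_nonneg ⟪γ s, deriv γ s⟫, sq_nonneg ⟪γ s, k s⟫]
  · nlinarith [sq_nonneg ⟪γ s, deriv γ s⟫, sq_nonneg ⟪γ s, k s⟫]
  · exact (sq_eq_sq₀ (norm_nonneg _) (norm_nonneg _)).1
      (is_const_of_deriv_eq_zero (fun t => (dκ t).differentiableAt) (fun t => (dκ t).deriv) s 0)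
end

section
/- Let e₁, e₂ be orthonormal vectors in ℝ^{d+1} with associated equiangular unit vectors u₁, u₂, u₃. Define the quadratic form Q on ℝ^{d+1} × ℝ^{d+1} by Q(v,w) := -(π/4)·∑_{j=1}^{3} |(v+w) - ⟨v+w, u_j⟩u_j|². Then Q(v,w) ≤ 0 for all (v,w), and Q(v,w) = 0 if and only if w = -v. Hence the kernel of Q is exactly the diagonal subspace {(v,-v) : v ∈ ℝ^{d+1}}, which expresses the non-degeneracy in the sense of Bott of the critical manifold of standard θ-networks for the reduced length functional (Lemma 4.4 of the paper). -/
open scoped RealInnerProductSpace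

/-- A vector that is a multiple of `e₁` and also of `a • e₁ + b • e₂`, with `e₁ ⟂ e₂`, `e₂ ≠ 0` and
`b ≠ 0`, vanishes. -/
theorem eq_zero_of_eq_smul_of_eq_smul_add {E : Type*} [NormedAddCommGroup E]
    [InnerProductSpace ℝ E] {e₁ e₂ x : E} (he₂ : e₂ ≠ 0) (he : ⟪e₁, e₂⟫ = 0) {a b s t : ℝ}
    (hb : b ≠ 0) (h₁ : x = s • e₁) (h₂ : x = t • (a • e₁ + b • e₂)) : x = 0 := by
  have h : ⟪s • e₁, e₂⟫ = ⟪t • (a • e₁ + b • e₂), e₂⟫ := by rw [← h₁, ← h₂]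
  simp only [inner_smul_left, inner_add_left, he] at h
  have ht : t = 0 := by simpa [hb, he₂] using h.symm
  rw [h₂, ht, zero_smul]

theorem stmt15 {d : ℕ} (hd : 2 ≤ d)
    (e₁ e₂ : EuclideanSpace ℝ (Fin (d + 1)))
    (he₁ : ‖e₁‖ = 1) (he₂ : ‖e₂‖ = 1) (he : ⟪e₁, e₂⟫ = 0)
    (u₁ u₂ u₃ : EuclideanSpace ℝ (Fin (d + 1)))
    (hu₁ : u₁ = e₁)
    (hu₂ : u₂ = -(1 / 2 : ℝ) • e₁ + (Real.sqrt 3 / 2) • e₂)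
    (hu₃ : u₃ = -(1 / 2 : ℝ) • e₁ - (Real.sqrt 3 / 2) • e₂)
    (Q : EuclideanSpace ℝ (Fin (d + 1)) → EuclideanSpace ℝ (Fin (d + 1)) → ℝ)
    (hQ : ∀ v w, Q v w = -(Real.pi / 4) *
      (‖(v + w) - ⟪v + w, u₁⟫ • u₁‖ ^ 2 + ‖(v + w) - ⟪v + w, u₂⟫ • u₂‖ ^ 2 +
        ‖(v + w) - ⟪v + w, u₃⟫ • u₃‖ ^ 2)) :
    ∀ v w : EuclideanSpace ℝ (Fin (d + 1)),
      Q v w ≤ 0 ∧ (Q v w = 0 ↔ w = -v) := by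
  intro v w
  rw [hQ]
  have hpi := Real.pi_pos
  refine ⟨mul_nonpos_of_nonpos_of_nonneg (by linarith) (by positivity), fun h => ?_, ?_⟩
  · have hsum := (mul_eq_zero.mp h).resolve_left (by linarith)
    have key : ∀ u : EuclideanSpace ℝ (Fin (d + 1)),
        ‖(v + w) - ⟪v + w, u⟫ • u‖ ^ 2 = 0 → v + w = ⟪v + w, u⟫ • u := fun u hu =>
      sub_eq_zero.mp (norm_eq_zero.mp (pow_eq_zero_iff two_ne_zero |>.mp hu))
    have n₁ := sq_nonneg ‖(v + w) - ⟪v + w, u₁⟫ • u₁‖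
    have n₂ := sq_nonneg ‖(v + w) - ⟪v + w, u₂⟫ • u₂‖
    have n₃ := sq_nonneg ‖(v + w) - ⟪v + w, u₃⟫ • u₃‖
    have h₁ := key u₁ (by linarith)
    have h₂ := key u₂ (by linarith)
    exact eq_neg_of_add_eq_zero_right (eq_zero_of_eq_smul_of_eq_smul_add
      (b := Real.sqrt 3 / 2)
      (norm_ne_zero_iff.mp (by simp [he₂])) he (by positivity) (hu₁ ▸ h₁)
      (h₂.trans (congrArg (⟪v + w, u₂⟫ • ·) hu₂)))
  · rintro rfl
    simp
end
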